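/- arXiv:2505.22646 — 4 statements merged into one kernel-verified Lean document; each statement's English description precedes it below -/
import Mathlib

section
/- Suppose U, V₁, V₂, V₃ are Banach spaces, U is finite-dimensional, γ > 0, and f : U → L(V₁, V₂) and g : U → L(V₂, V₃) are Lip(γ) functions, where L(·,·) denotes the space of bounded linear operators with the operator norm. Then the pointwise composition h : U → L(V₁, V₃) defined by h(u) := g(u) ∘ f(u) for all u ∈ U is a Lip(γ) function, and moreover ‖h‖_{Lip(γ)} ≤ K · ‖f‖_{Lip(γ)} · ‖g‖_{Lip(γ)}, where K > 0 is a constant that depends only on γ and the dimension of U. -/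
/-- `steinDeg γ` is the largest integer strictly smaller than `γ` (for `γ > 0`). -/
noncomputable def steinDeg (γ : ℝ) : ℕ := ⌈γ⌉₊ - 1

/-- The set of admissible bounds `M` in Stein's definition of a `Lip(γ)` function:
`M ≥ 0` bounds all iterated Fréchet derivatives up to order `γ₀ = steinDeg γ`, and the
`γ₀`-th derivative is `(γ - γ₀)`-Hölder with constant `M`. -/
def lipBoundSet (γ : ℝ) {U W : Type*} [NormedAddCommGroup U] [NormedSpace ℝ U]
    [NormedAddCommGroup W] [NormedSpace ℝ W] (f : U → W) : Set ℝ :=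
  {M | 0 ≤ M ∧
    (∀ k ≤ steinDeg γ, ∀ u : U, ‖iteratedFDeriv ℝ k f u‖ ≤ M) ∧
    (∀ u₁ u₂ : U,
      ‖iteratedFDeriv ℝ (steinDeg γ) f u₁ - iteratedFDeriv ℝ (steinDeg γ) f u₂‖
        ≤ M * ‖u₁ - u₂‖ ^ (γ - (steinDeg γ : ℝ)))}

/-- `f` is `Lip(γ)` in the sense of Stein: `γ₀`-times continuously differentiable and
there is an admissible bound `M`. -/
def IsLipGamma (γ : ℝ) {U W : Type*} [NormedAddCommGroup U] [NormedSpace ℝ U]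
    [NormedAddCommGroup W] [NormedSpace ℝ W] (f : U → W) : Prop :=
  ContDiff ℝ (steinDeg γ) f ∧ (lipBoundSet γ f).Nonempty

/-- The `Lip(γ)` norm of `f`: the smallest admissible bound `M`. -/
noncomputable def lipGammaNorm (γ : ℝ) {U W : Type*} [NormedAddCommGroup U] [NormedSpace ℝ U]
    [NormedAddCommGroup W] [NormedSpace ℝ W] (f : U → W) : ℝ :=
  sInf (lipBoundSet γ f)

theorem steinDeg_lt {γ : ℝ} (hγ : 0 < γ) : (steinDeg γ : ℝ) < γ := by
  have h : 0 < ⌈γ⌉₊ := Nat.ceil_pos.2 hγ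
  exact Nat.lt_ceil.1 (by unfold steinDeg; omega)

theorem le_steinDeg_add_one (γ : ℝ) : γ ≤ steinDeg γ + 1 := by
  have h : ⌈γ⌉₊ ≤ steinDeg γ + 1 := by unfold steinDeg; omega
  exact_mod_cast Nat.ceil_le.1 h

section

variable {U E F G : Type*} [NormedAddCommGroup U] [NormedSpace ℝ U]
  [NormedAddCommGroup E] [NormedSpace ℝ E] [NormedAddCommGroup F] [NormedSpace ℝ F]
  [NormedAddCommGroup G] [NormedSpace ℝ G] {γ : ℝ}

theorem lipGammaNorm_mem_lipBoundSet {f : U → E} (hf : (lipBoundSet γ f).Nonempty) :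
    lipGammaNorm γ f ∈ lipBoundSet γ f := by
  have hclosed : IsClosed (lipBoundSet γ f) := by
    simp only [lipBoundSet, Set.ofPred_and, Set.ofPred_forall]
    refine isClosed_Ici.inter (IsClosed.inter ?_ ?_)
    · exact isClosed_iInter fun k => isClosed_iInter fun _ => isClosed_iInter fun u =>
        isClosed_le continuous_const continuous_id
    · exact isClosed_iInter fun u₁ => isClosed_iInter fun u₂ =>
        isClosed_le continuous_const (continuous_id.mul continuous_const)
  exact hclosed.csInf_mem hf ⟨0, fun _ hM => hM.1⟩

theorem lipGammaNorm_le_of_mem_lipBoundSet {f : U → E} {M : ℝ} (hM : M ∈ lipBoundSet γ f) :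
    lipGammaNorm γ f ≤ M :=
  csInf_le ⟨0, fun _ h => h.1⟩ hM

theorem min_two_le_two_mul_rpow {α t : ℝ} (hα : 0 ≤ α) (hα1 : α ≤ 1) (ht : 0 ≤ t) :
    min 2 t ≤ 2 * t ^ α := by
  rcases le_total t 1 with h | h
  · have : t ≤ t ^ α := by
      rcases ht.eq_or_lt with rfl | h0
      · exact Real.rpow_nonneg le_rfl _
      · simpa using Real.rpow_le_rpow_of_exponent_ge h0 h hα1
    linarith [min_le_right 2 t]
  · linarith [min_le_left 2 t, Real.one_le_rpow h hα]

/-- All derivatives of order at most `steinDeg γ` of a `Lip(γ)` function are Hölder, with the same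
exponent as the top one. -/
theorem norm_iteratedFDeriv_sub_le_of_mem_lipBoundSet (hγ : 0 < γ) {f : U → E} {M : ℝ}
    (hf : ContDiff ℝ (steinDeg γ) f) (hM : M ∈ lipBoundSet γ f) {k : ℕ} (hk : k ≤ steinDeg γ)
    (u v : U) :
    ‖iteratedFDeriv ℝ k f u - iteratedFDeriv ℝ k f v‖
      ≤ 2 * M * ‖u - v‖ ^ (γ - (steinDeg γ : ℝ)) := by
  obtain ⟨hM0, hbound, hholder⟩ := hM
  have hpow : 0 ≤ ‖u - v‖ ^ (γ - (steinDeg γ : ℝ)) := by positivity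
  rcases hk.eq_or_lt with rfl | hk
  · refine (hholder u v).trans ?_
    gcongr
    linarith
  · have hlip : ‖iteratedFDeriv ℝ k f u - iteratedFDeriv ℝ k f v‖ ≤ M * ‖u - v‖ :=
      convex_univ.norm_image_sub_le_of_norm_fderiv_le
        (fun x _ => hf.differentiable_iteratedFDeriv (mod_cast hk) x)
        (fun x _ => norm_fderiv_iteratedFDeriv.trans_le (hbound (k + 1) hk x))
        (Set.mem_univ v) (Set.mem_univ u)
    have hbdd : ‖iteratedFDeriv ℝ k f u - iteratedFDeriv ℝ k f v‖ ≤ M * 2 :=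
      (norm_sub_le _ _).trans (by linarith [hbound k hk.le u, hbound k hk.le v])
    calc ‖iteratedFDeriv ℝ k f u - iteratedFDeriv ℝ k f v‖
        ≤ M * min 2 ‖u - v‖ := by
          rw [mul_min_of_nonneg _ _ hM0]
          exact le_min hbdd hlip
      _ ≤ M * (2 * ‖u - v‖ ^ (γ - (steinDeg γ : ℝ))) := by
          gcongr
          exact min_two_le_two_mul_rpow (by linarith [steinDeg_lt hγ])
            (by linarith [le_steinDeg_add_one γ]) (norm_nonneg _)
      _ = _ := by ring

theorem ContinuousLinearMap.norm_iteratedFDeriv_bilinear_le_two_pow_mul (B : E →L[ℝ] F →L[ℝ] G)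
    (hB : ‖B‖ ≤ 1) {f : U → E} {g : U → F} {n : ℕ} (hf : ContDiff ℝ n f) (hg : ContDiff ℝ n g)
    {x : U} {a b : ℝ} (ha : ∀ i ≤ n, ‖iteratedFDeriv ℝ i f x‖ ≤ a)
    (hb : ∀ i ≤ n, ‖iteratedFDeriv ℝ i g x‖ ≤ b) :
    ‖iteratedFDeriv ℝ n (fun y => B (f y) (g y)) x‖ ≤ 2 ^ n * (a * b) := by
  have ha0 : 0 ≤ a := (norm_nonneg _).trans (ha 0 n.zero_le)
  calc ‖iteratedFDeriv ℝ n (fun y => B (f y) (g y)) x‖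
      ≤ ∑ i ∈ Finset.range (n + 1),
          (n.choose i : ℝ) * ‖iteratedFDeriv ℝ i f x‖ * ‖iteratedFDeriv ℝ (n - i) g x‖ :=
        B.norm_iteratedFDeriv_le_of_bilinear_of_le_one hf hg x le_rfl hB
    _ ≤ ∑ i ∈ Finset.range (n + 1), (n.choose i : ℝ) * (a * b) := by
        refine Finset.sum_le_sum fun i hi => ?_
        rw [mul_assoc]
        gcongr
        · exact ha i (by simpa [Nat.lt_succ_iff] using hi)
        · exact hb _ (Nat.sub_le _ _)
    _ = 2 ^ n * (a * b) := by
        rw [← Finset.sum_mul, ← Nat.cast_sum, Nat.sum_range_choose]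
        push_cast
        ring

theorem iteratedFDeriv_sub_comp_add_right {f : U → E} {n : ℕ} (hf : ContDiff ℝ n f) (t x : U) :
    iteratedFDeriv ℝ n (fun y => f y - f (y + t)) x
      = iteratedFDeriv ℝ n f x - iteratedFDeriv ℝ n f (x + t) := by
  have ht : ContDiff ℝ n fun y => f (y + t) := by fun_prop
  rw [fun_iteratedFDeriv_sub_apply hf.contDiffAt ht.contDiffAt, iteratedFDeriv_comp_add_right]

/-- The Hölder bound comes from differentiating
`h(y) - h(y + t) = B (f y - f (y + t)) (g y) + B (f (y + t)) (g y - g (y + t))`. -/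
theorem ContinuousLinearMap.mul_mem_lipBoundSet_bilinear (hγ : 0 < γ) (B : E →L[ℝ] F →L[ℝ] G)
    (hB : ‖B‖ ≤ 1) {f : U → E} {g : U → F} {M N : ℝ} (hf : ContDiff ℝ (steinDeg γ) f)
    (hg : ContDiff ℝ (steinDeg γ) g) (hM : M ∈ lipBoundSet γ f) (hN : N ∈ lipBoundSet γ g) :
    2 ^ (steinDeg γ + 2) * (M * N) ∈ lipBoundSet γ fun y => B (f y) (g y) := by
  have hMN : 0 ≤ M * N := mul_nonneg hM.1 hN.1
  refine ⟨by positivity, fun k hk u => ?_, fun u v => ?_⟩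
  · have hk' : (k : WithTop ℕ∞) ≤ steinDeg γ := by exact_mod_cast hk
    refine (B.norm_iteratedFDeriv_bilinear_le_two_pow_mul hB (hf.of_le hk') (hg.of_le hk')
      (fun i hi => hM.2.1 i (hi.trans hk) u) (fun i hi => hN.2.1 i (hi.trans hk) u)).trans ?_
    gcongr
    · norm_num
    · omega
  · obtain ⟨t, rfl⟩ : ∃ t, v = u + t := ⟨v - u, by abel⟩
    set n := steinDeg γ
    set c := ‖u - (u + t)‖ ^ (γ - (n : ℝ))
    have hft : ContDiff ℝ n fun y => f (y + t) := by fun_prop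
    have hgt : ContDiff ℝ n fun y => g (y + t) := by fun_prop
    have hfd : ∀ i ≤ n, ‖iteratedFDeriv ℝ i (fun y => f y - f (y + t)) u‖ ≤ 2 * M * c := by
      intro i hi
      rw [iteratedFDeriv_sub_comp_add_right (hf.of_le (mod_cast hi))]
      exact norm_iteratedFDeriv_sub_le_of_mem_lipBoundSet hγ hf hM hi _ _
    have hgd : ∀ i ≤ n, ‖iteratedFDeriv ℝ i (fun y => g y - g (y + t)) u‖ ≤ 2 * N * c := by
      intro i hi
      rw [iteratedFDeriv_sub_comp_add_right (hg.of_le (mod_cast hi))]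
      exact norm_iteratedFDeriv_sub_le_of_mem_lipBoundSet hγ hg hN hi _ _
    have hfb : ∀ i ≤ n, ‖iteratedFDeriv ℝ i (fun y => f (y + t)) u‖ ≤ M := by
      intro i hi
      rw [iteratedFDeriv_comp_add_right]
      exact hM.2.1 i hi _
    have h₁ := B.norm_iteratedFDeriv_bilinear_le_two_pow_mul hB (hf.sub hft) hg hfd
      (fun i hi => hN.2.1 i hi u)
    have h₂ := B.norm_iteratedFDeriv_bilinear_le_two_pow_mul hB hft (hg.sub hgt) hfb hgd
    have hc₁ : ContDiff ℝ n fun y => B (f y - f (y + t)) (g y) :=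
      B.isBoundedBilinearMap.contDiff.comp₂ (hf.sub hft) hg
    have hc₂ : ContDiff ℝ n fun y => B (f (y + t)) (g y - g (y + t)) :=
      B.isBoundedBilinearMap.contDiff.comp₂ hft (hg.sub hgt)
    have hsplit : (fun y => B (f y) (g y) - B (f (y + t)) (g (y + t)))
        = fun y => B (f y - f (y + t)) (g y) + B (f (y + t)) (g y - g (y + t)) := by
      ext y
      simp
    rw [← iteratedFDeriv_sub_comp_add_right (f := fun y => B (f y) (g y))
      (B.isBoundedBilinearMap.contDiff.comp₂ hf hg), hsplit,
      fun_iteratedFDeriv_add_apply hc₁.contDiffAt hc₂.contDiffAt]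
    refine (norm_add_le _ _).trans ((add_le_add h₁ h₂).trans_eq ?_)
    ring

end

/-- If `U` is a finite-dimensional Banach space, `V₁, V₂, V₃` are Banach
spaces, and `f : U → L(V₁,V₂)`, `g : U → L(V₂,V₃)` are `Lip(γ)`, then the pointwise
composition `h(u) = g(u) ∘ f(u)` is `Lip(γ)`, with
`‖h‖_{Lip(γ)} ≤ K ‖f‖_{Lip(γ)} ‖g‖_{Lip(γ)}` for a constant `K > 0` depending only on `γ`
and (the dimension of) `U`. -/
theorem lipGamma_comp (γ : ℝ) (hγ : 0 < γ)
    (U : Type) [NormedAddCommGroup U] [NormedSpace ℝ U] [CompleteSpace U]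
    [FiniteDimensional ℝ U] :
    ∃ K : ℝ, 0 < K ∧
      ∀ (V₁ V₂ V₃ : Type)
        [NormedAddCommGroup V₁] [NormedSpace ℝ V₁] [CompleteSpace V₁]
        [NormedAddCommGroup V₂] [NormedSpace ℝ V₂] [CompleteSpace V₂]
        [NormedAddCommGroup V₃] [NormedSpace ℝ V₃] [CompleteSpace V₃]
        (f : U → V₁ →L[ℝ] V₂) (g : U → V₂ →L[ℝ] V₃),
        IsLipGamma γ f → IsLipGamma γ g →
          IsLipGamma γ (fun u => (g u).comp (f u)) ∧
          lipGammaNorm γ (fun u => (g u).comp (f u))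
            ≤ K * lipGammaNorm γ f * lipGammaNorm γ g := by
  refine ⟨2 ^ (steinDeg γ + 2), by positivity, ?_⟩
  intro V₁ V₂ V₃ _ _ _ _ _ _ _ _ _ f g ⟨hf, hfM⟩ ⟨hg, hgM⟩
  have h := (ContinuousLinearMap.compL ℝ V₁ V₂ V₃).mul_mem_lipBoundSet_bilinear hγ
    (ContinuousLinearMap.norm_compL_le ℝ V₁ V₂ V₃) hg hf
    (lipGammaNorm_mem_lipBoundSet hgM) (lipGammaNorm_mem_lipBoundSet hfM)
  refine ⟨⟨hg.clm_comp hf, _, h⟩, (lipGammaNorm_le_of_mem_lipBoundSet h).trans_eq ?_⟩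
  ring
end

section
/- Let d ∈ ℕ, Θ ⊆ ℝ^d, θ₀ an interior point of Θ, and P = (P¹, …, P^d) : Θ → ℝ^d a function that is differentiable at θ₀ with invertible Jacobian matrix J_P(θ₀). Then there exists ε₀ > 0 such that for every ε ∈ (0, ε₀] there exist a Miranda domain D and a Miranda partition 𝒟 = {D_1^+, D_1^−, …, D_d^+, D_d^−} of ∂D such that D ⊆ B_ε(θ₀) ∩ Θ, where B_ε(θ₀) is the open ball of radius ε around θ₀ in the ∞-norm on ℝ^d, and such that for every k ∈ {1, …, d}, (P^k(θ₁) − P^k(θ₀)) · (P^k(θ₂) − P^k(θ₀)) < 0 for all θ₁ ∈ D_k^+ and all θ₂ ∈ D_k^−. -/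
/-- The cube `Q(δ) = [-δ, δ]^d ⊆ ℝ^d`. -/
def cube (d : ℕ) (δ : ℝ) : Set (Fin d → ℝ) := {x | ∀ i, |x i| ≤ δ}

/-- The face `Q_k(δ)⁺ = {x ∈ Q(δ) : x_k = δ}`. -/
def facePlus (d : ℕ) (δ : ℝ) (k : Fin d) : Set (Fin d → ℝ) :=
  {x | x ∈ cube d δ ∧ x k = δ}

/-- The face `Q_k(δ)⁻ = {x ∈ Q(δ) : x_k = -δ}`. -/
def faceMinus (d : ℕ) (δ : ℝ) (k : Fin d) : Set (Fin d → ℝ) :=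
  {x | x ∈ cube d δ ∧ x k = -δ}

/-- `g` is a Miranda mapping for `D`: a continuous map on `Q(1)` which maps `Q(1)` onto `D`
and `∂Q(1)` onto `∂D`. -/
def IsMirandaMapping (d : ℕ) (D : Set (Fin d → ℝ))
    (g : (Fin d → ℝ) → (Fin d → ℝ)) : Prop :=
  ContinuousOn g (cube d 1) ∧ g '' cube d 1 = D ∧
    g '' frontier (cube d 1) = frontier D

/-- `D ⊆ ℝ^d` is a Miranda domain: there exists a Miranda mapping for it. -/
def IsMirandaDomain (d : ℕ) (D : Set (Fin d → ℝ)) : Prop :=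
  ∃ g, IsMirandaMapping d D g

/-- `{Dp k, Dm k}_k` is a Miranda partition of `∂D`: some Miranda mapping `g` for `D`
carries the faces `Q_k(1)⁺`, `Q_k(1)⁻` onto `Dp k`, `Dm k` respectively. -/
def IsMirandaPartition (d : ℕ) (D : Set (Fin d → ℝ))
    (Dp Dm : Fin d → Set (Fin d → ℝ)) : Prop :=
  ∃ g, IsMirandaMapping d D g ∧
    ∀ k, g '' facePlus d 1 k = Dp k ∧ g '' faceMinus d 1 k = Dm k

/-- The affine homeomorphism `x ↦ θ₀ + δ • J⁻¹ x`. -/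
noncomputable def mirandaChart {d : ℕ} (θ₀ : Fin d → ℝ)
    (J : (Fin d → ℝ) ≃L[ℝ] (Fin d → ℝ)) {δ : ℝ} (hδ : δ ≠ 0) :
    (Fin d → ℝ) ≃ₜ (Fin d → ℝ) :=
  (J.symm.toHomeomorph.trans (Homeomorph.smulOfNeZero δ hδ)).trans (Homeomorph.addLeft θ₀)

theorem mirandaChart_apply {d : ℕ} (θ₀ : Fin d → ℝ)
    (J : (Fin d → ℝ) ≃L[ℝ] (Fin d → ℝ)) {δ : ℝ} (hδ : δ ≠ 0) (x : Fin d → ℝ) :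
    mirandaChart θ₀ J hδ x = θ₀ + δ • J.symm x := rfl

theorem isMirandaMapping_homeomorph {d : ℕ} (g : (Fin d → ℝ) ≃ₜ (Fin d → ℝ)) :
    IsMirandaMapping d (g '' cube d 1) g :=
  ⟨g.continuous.continuousOn, rfl, g.image_frontier _⟩

theorem norm_le_of_mem_cube {d : ℕ} {δ : ℝ} (hδ : 0 ≤ δ) {x : Fin d → ℝ}
    (hx : x ∈ cube d δ) : ‖x‖ ≤ δ :=
  (pi_norm_le_iff_of_nonneg hδ).2 hx

/-- If `P : Θ → ℝ^d` is differentiable at an interior point `θ₀` of `Θ`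
with invertible Jacobian, then there is `ε₀ > 0` such that for every `ε ∈ (0, ε₀]` there
is a Miranda domain `D` with Miranda partition `{Dp k, Dm k}` of `∂D`, contained in
`B_ε(θ₀) ∩ Θ` (ball in the `∞`-norm), on which the strict sign conditions
`(P^k(θ₁) - P^k(θ₀)) (P^k(θ₂) - P^k(θ₀)) < 0` hold for all `θ₁ ∈ Dp k`, `θ₂ ∈ Dm k`. -/
theorem exists_miranda_domain_of_invertible_jacobian
    (d : ℕ) (Θ : Set (Fin d → ℝ)) (θ₀ : Fin d → ℝ) (hθ₀ : θ₀ ∈ interior Θ)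
    (P : (Fin d → ℝ) → (Fin d → ℝ)) (J : (Fin d → ℝ) ≃L[ℝ] (Fin d → ℝ))
    (hP : HasFDerivAt P (J : (Fin d → ℝ) →L[ℝ] (Fin d → ℝ)) θ₀) :
    ∃ ε₀ > (0 : ℝ), ∀ ε ∈ Set.Ioc (0 : ℝ) ε₀,
      ∃ (D : Set (Fin d → ℝ)) (Dp Dm : Fin d → Set (Fin d → ℝ)),
        IsMirandaDomain d D ∧ IsMirandaPartition d D Dp Dm ∧
        D ⊆ Metric.ball θ₀ ε ∩ Θ ∧
        ∀ k : Fin d, ∀ θ₁ ∈ Dp k, ∀ θ₂ ∈ Dm k,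
          (P θ₁ k - P θ₀ k) * (P θ₂ k - P θ₀ k) < 0 := by
  set M : ℝ := ‖(J.symm : (Fin d → ℝ) →L[ℝ] (Fin d → ℝ))‖ + 1 with hM
  have hM0 : 0 < M := by positivity
  have hΘ : ∀ᶠ θ in nhds θ₀, θ ∈ Θ := mem_interior_iff_mem_nhds.1 hθ₀
  obtain ⟨r, hr, hball⟩ := Metric.eventually_nhds_iff_ball.1
    (hΘ.and (hP.isLittleO.def (c := 1 / (2 * M)) (by positivity)))
  refine ⟨r, hr, fun ε ⟨hε, hεr⟩ => ?_⟩
  set δ : ℝ := ε / (2 * M) with hδ_def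
  have hδ : 0 < δ := by positivity
  have hδM : δ * M = ε / 2 := by rw [hδ_def]; field_simp
  let g := mirandaChart θ₀ J hδ.ne'
  have hgx (x : Fin d → ℝ) : g x = θ₀ + δ • J.symm x := mirandaChart_apply θ₀ J hδ.ne' x
  have hnorm : ∀ x ∈ cube d 1, ‖g x - θ₀‖ ≤ δ * M := by
    intro x hx
    rw [hgx, add_sub_cancel_left, norm_smul, Real.norm_of_nonneg hδ.le]
    gcongr
    have h := (J.symm : (Fin d → ℝ) →L[ℝ] (Fin d → ℝ)).le_of_opNorm_le_of_le le_rfl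
      (norm_le_of_mem_cube zero_le_one hx)
    simp only [ContinuousLinearEquiv.coe_coe] at h
    linarith
  have hmem : ∀ x ∈ cube d 1, g x ∈ Metric.ball θ₀ ε := by
    intro x hx
    rw [mem_ball_iff_norm]
    linarith [hnorm x hx]
  have hest : ∀ x ∈ cube d 1, ∀ k, |P (g x) k - P θ₀ k - δ * x k| ≤ δ / 2 := by
    intro x hx k
    have h := (hball _ (Metric.ball_subset_ball hεr (hmem x hx))).2
    have hJ : J (g x - θ₀) = δ • x := by
      rw [hgx, add_sub_cancel_left, map_smul, J.apply_symm_apply]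
    rw [ContinuousLinearEquiv.coe_coe, hJ] at h
    calc |P (g x) k - P θ₀ k - δ * x k| = ‖(P (g x) - P θ₀ - δ • x) k‖ := by simp
      _ ≤ ‖P (g x) - P θ₀ - δ • x‖ := norm_le_pi_norm _ k
      _ ≤ 1 / (2 * M) * ‖g x - θ₀‖ := h
      _ ≤ 1 / (2 * M) * (δ * M) := by gcongr; exact hnorm x hx
      _ = δ / 2 := by field_simp
  refine ⟨g '' cube d 1, fun k => g '' facePlus d 1 k, fun k => g '' faceMinus d 1 k,
    ⟨g, isMirandaMapping_homeomorph g⟩,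
    ⟨g, isMirandaMapping_homeomorph g, fun k => ⟨rfl, rfl⟩⟩, ?_, ?_⟩
  · rintro _ ⟨x, hx, rfl⟩
    exact ⟨hmem x hx, (hball _ (Metric.ball_subset_ball hεr (hmem x hx))).1⟩
  · rintro k _ ⟨x, ⟨hx, hxk⟩, rfl⟩ _ ⟨y, ⟨hy, hyk⟩, rfl⟩
    have h₁ := abs_le.1 (hest x hx k)
    have h₂ := abs_le.1 (hest y hy k)
    rw [hxk] at h₁
    rw [hyk] at h₂
    exact mul_neg_of_pos_of_neg (by linarith) (by linarith)
end

section
/- Let d ∈ ℕ and let h = (h¹, …, h^d) : W → ℝ^d be a function defined on a neighborhood W of 0 in ℝ^d that is differentiable at 0 with derivative equal to the identity map on ℝ^d. Then there exists ε₀ > 0 with [−ε₀, ε₀]^d ⊆ W such that for every δ ∈ (0, ε₀], every k ∈ {1, …, d}, and every θ = (θ¹, …, θ^d) ∈ [−δ, δ]^d: if θ^k = δ then h^k(θ) − h^k(0) > δ/2, and if θ^k = −δ then h^k(θ) − h^k(0) < −δ/2. -/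
/-- Let `h : W → ℝ^d` be defined on a neighborhood `W` of `0` in `ℝ^d`
and differentiable at `0` (relative to `W`) with derivative the identity. Then there is
`ε₀ > 0` with `[-ε₀, ε₀]^d ⊆ W` such that for all `δ ∈ (0, ε₀]`, all `k`, and all
`θ ∈ [-δ, δ]^d`: if `θ_k = δ` then `h^k(θ) - h^k(0) > δ/2`, and if `θ_k = -δ` then
`h^k(θ) - h^k(0) < -δ/2`. -/
theorem cube_face_sign_of_hasFDerivAt_id
    (d : ℕ) (W : Set (Fin d → ℝ)) (hW : W ∈ nhds (0 : Fin d → ℝ))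
    (h : (Fin d → ℝ) → (Fin d → ℝ))
    (hdiff : HasFDerivWithinAt h (ContinuousLinearMap.id ℝ (Fin d → ℝ)) W 0) :
    ∃ ε₀ > (0 : ℝ), cube d ε₀ ⊆ W ∧
      ∀ δ ∈ Set.Ioc (0 : ℝ) ε₀, ∀ k : Fin d, ∀ θ ∈ cube d δ,
        (θ k = δ → h θ k - h 0 k > δ / 2) ∧
        (θ k = -δ → h θ k - h 0 k < -(δ / 2)) := by
  have hremainder : ∀ᶠ θ in nhds (0 : Fin d → ℝ), ‖h θ - h 0 - θ‖ ≤ 1 / 3 * ‖θ‖ := by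
    simpa using (hdiff.hasFDerivAt hW).isLittleO.def (by norm_num : (0 : ℝ) < 1 / 3)
  obtain ⟨ε, hε, hball⟩ := Metric.nhds_basis_closedBall.mem_iff.1
    (Filter.inter_mem hW hremainder)
  have norm_le_of_mem_cube : ∀ {δ : ℝ}, 0 ≤ δ → ∀ θ ∈ cube d δ, ‖θ‖ ≤ δ :=
    fun hδ θ hθ => (pi_norm_le_iff_of_nonneg hδ).2 hθ
  refine ⟨ε, hε, fun θ hθ => (hball ?_).1, fun δ hδ k θ hθ => ?_⟩
  · simpa using norm_le_of_mem_cube hε.le θ hθ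
  · have hnorm := norm_le_of_mem_cube hδ.1.le θ hθ
    have hmem : θ ∈ Metric.closedBall (0 : Fin d → ℝ) ε := by
      simpa using hnorm.trans hδ.2
    have hbound : ‖h θ - h 0 - θ‖ ≤ 1 / 3 * ‖θ‖ := (hball hmem).2
    have hcoord : |h θ k - h 0 k - θ k| ≤ ‖h θ - h 0 - θ‖ :=
      norm_le_pi_norm (h θ - h 0 - θ) k
    have hpos := hδ.1
    obtain ⟨hlower, hupper⟩ := abs_le.1 (hcoord.trans hbound)
    constructor <;> intro hk <;> rw [hk] at hlower hupper <;> linarith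
end

section
/- Let d ∈ ℕ, let (D, 𝒟) be a Miranda domain in ℝ^d with Miranda partition 𝒟 = {D_k^+, D_k^−}_{k=1}^d, let c = (c_1, …, c_d) ∈ ℝ^d, and let f = (f¹, …, f^d) : D → ℝ^d be continuous with f^k(θ₁) > c_k for all θ₁ ∈ D_k^+ and f^k(θ₂) < c_k for all θ₂ ∈ D_k^−, for each k ∈ {1, …, d}. For each k define η_k := (1/2) · min{ min_{θ ∈ D_k^+} (f^k(θ) − c_k), min_{θ ∈ D_k^−} (c_k − f^k(θ)) }, which is a positive real number. Then for every continuous G = (G¹, …, G^d) : D → ℝ^d satisfying sup_{θ ∈ D} |G^k(θ) − f^k(θ)| < η_k for all k, and every c' = (c'_1, …, c'_d) ∈ ℝ^d with |c'_k − c_k| < η_k for all k, there exists θ* ∈ D with G(θ*) = c'. -/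
/-- The margin `η_k = (1/2) min { min_{θ ∈ Dp k} (f^k θ - c_k), min_{θ ∈ Dm k} (c_k - f^k θ) }`. -/
noncomputable def mirandaMargin (d : ℕ) (Dp Dm : Fin d → Set (Fin d → ℝ))
    (c : Fin d → ℝ) (f : (Fin d → ℝ) → (Fin d → ℝ)) (k : Fin d) : ℝ :=
  (1 / 2) * min (sInf ((fun θ => f θ k - c k) '' Dp k))
    (sInf ((fun θ => c k - f θ k) '' Dm k))

theorem even_card_of_existsUnique_symm {α : Type*} (s : Finset α) (rel : α → α → Prop)
    (hirr : ∀ x ∈ s, ¬ rel x x) (hsymm : ∀ x ∈ s, ∀ y ∈ s, rel x y → rel y x)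
    (hex : ∀ x ∈ s, ∃! y, y ∈ s ∧ rel x y) : Even s.card := by
  classical
  choose! g hg huniq using hex
  have h : ∑ x ∈ s, (1 : ZMod 2) = 0 := by
    refine Finset.sum_involution (fun x _ => g x) (fun _ _ => by decide) ?_
      (fun x hx => (hg x hx).1) ?_
    · intro x hx _ h
      have := (hg x hx).2
      rw [h] at this
      exact hirr x hx this
    · intro x hx
      have h := hg x hx
      exact (huniq _ h.1 x ⟨hx, hsymm x hx _ h.1 h.2⟩).symm
  rw [Finset.sum_const, nsmul_eq_mul, mul_one] at h
  exact (ZMod.natCast_eq_zero_iff_even).1 h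

/-- A dominating family for the rankings `r i`: `a i` is the `r i`-smallest value of `a`, the
values are distinct, and no `y` beats `a i` strictly in every ranking. -/
structure IsPrimitiveFamily {ι V : Type*} (r : ι → V → ℕ) (a : ι → V) : Prop where
  min : ∀ i j, r i (a i) ≤ r i (a j)
  injective : Function.Injective a
  dominates : ∀ y, ∃ i, r i y ≤ r i (a i)

/-- `b` arises from `a` by dropping the `k`-th member, moving the `l`-th member to position `k`,
and entering a new member at position `l`. -/
def IsPivot {ι V : Type*} (a : ι → V) (k : ι) (b : ι → V) (l : ι) : Prop :=
  k ≠ l ∧ b k = a l ∧ ∀ i, i ≠ k → i ≠ l → b i = a i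

theorem IsPivot.symm {ι V : Type*} {a b : ι → V} {k l : ι} (h : IsPivot a k b l) :
    IsPivot b l a k :=
  ⟨h.1.symm, h.2.1.symm, fun i hl hk => (h.2.2 i hk hl).symm⟩

section Pivot

variable {ι V : Type*} {r : ι → V → ℕ}

theorem IsPivot.unique (hr : ∀ i, Function.Injective (r i))
    {a b b' : ι → V} {k l l' : ι} (ha : IsPrimitiveFamily r a)
    (hb : IsPrimitiveFamily r b) (hb' : IsPrimitiveFamily r b')
    (h : IsPivot a k b l) (h' : IsPivot a k b' l') : b = b' ∧ l = l' := by
  have key : ∀ {b b' : ι → V} {l l' : ι}, IsPrimitiveFamily r b → IsPivot a k b l →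
      IsPivot a k b' l' → r k (a l) ≤ r k (a l') := by
    intro b b' l l' hb h h'
    by_cases hll : l' = l
    · rw [hll]
    · have := hb.min k l'
      rwa [h.2.1, h.2.2 l' h'.1.symm hll] at this
  have hl : l = l' := ha.injective (hr k (le_antisymm (key hb h h') (key hb' h' h)))
  subst hl
  have hlt : ∀ {b b' : ι → V}, IsPrimitiveFamily r b → IsPrimitiveFamily r b' →
      IsPivot a k b l → IsPivot a k b' l → r l (b l) ≤ r l (b' l) := by
    intro b b' hb hb' h h'
    obtain ⟨i, hi⟩ := hb'.dominates (b l)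
    by_cases hil : i = l
    · rwa [hil] at hi
    · have hbi : b' i = b i := by
        by_cases hik : i = k
        · rw [hik, h.2.1, h'.2.1]
        · rw [h.2.2 i hik hil, h'.2.2 i hik hil]
      rw [hbi] at hi
      exact absurd (hb.injective (hr i (le_antisymm hi (hb.min i l)))).symm hil
  refine ⟨funext fun i => ?_, rfl⟩
  by_cases hil : i = l
  · rw [hil]
    exact hr l (le_antisymm (hlt hb hb' h h') (hlt hb' hb h' h))
  · by_cases hik : i = k
    · rw [hik, h.2.1, h'.2.1]
    · rw [h.2.2 i hik hil, h'.2.2 i hik hil]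

theorem IsPrimitiveFamily.exists_pivot [DecidableEq ι] [Finite V]
    {a : ι → V} {k l : ι} (ha : IsPrimitiveFamily r a)
    (hkl : k ≠ l) (hl : ∀ i, i ≠ k → r k (a l) ≤ r k (a i))
    (hne : ∃ y, r k (a l) < r k y ∧ ∀ i, i ≠ k → i ≠ l → r i (a i) < r i y) :
    ∃ b, IsPrimitiveFamily r b ∧ IsPivot a k b l := by
  obtain ⟨x, ⟨hxk, hxi⟩, hmax⟩ := Set.exists_max_image
    {y | r k (a l) < r k y ∧ ∀ i, i ≠ k → i ≠ l → r i (a i) < r i y} (r l) (Set.toFinite _) hne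
  have hxl : r l x ≤ r l (a l) := by
    obtain ⟨i, hi⟩ := ha.dominates x
    by_cases hik : i = k
    · subst hik
      have := ha.min i l
      omega
    · by_cases hil : i = l
      · rwa [hil] at hi
      · have := hxi i hik hil
        omega
  have hxa : ∀ i, i ≠ k → x ≠ a i := by
    rintro i hik rfl
    by_cases hil : i = l
    · rw [hil] at hxk
      omega
    · exact lt_irrefl _ (hxi i hik hil)
  obtain ⟨b, hbk, hbl, hbi⟩ : ∃ b : ι → V, b k = a l ∧ b l = x ∧
      ∀ i, i ≠ k → i ≠ l → b i = a i :=
    ⟨Function.update (Function.update a k (a l)) l x, by simp [hkl], by simp,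
      fun i hik hil => by simp [hik, hil]⟩
  have hb : ∀ j, j = l ∧ b j = x ∨ ∃ j', j' ≠ k ∧ b j = a j' ∧
      (j = k ∧ j' = l ∨ j ≠ k ∧ j' = j ∧ j ≠ l) := by
    intro j
    by_cases hjl : j = l
    · exact Or.inl ⟨hjl, hjl ▸ hbl⟩
    · right
      by_cases hjk : j = k
      · exact ⟨l, hkl.symm, hjk ▸ hbk, Or.inl ⟨hjk, rfl⟩⟩
      · exact ⟨j, hjk, hbi j hjk hjl, Or.inr ⟨hjk, rfl, hjl⟩⟩
  refine ⟨b, ⟨?_, ?_, ?_⟩, hkl, hbk, hbi⟩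
  · intro i j
    by_cases hil : i = l
    · subst hil
      rw [hbl]
      rcases hb j with ⟨-, h⟩ | ⟨j', -, h, -⟩
      · rw [h]
      · rw [h]
        exact hxl.trans (ha.min i j')
    · by_cases hik : i = k
      · subst hik
        rw [hbk]
        rcases hb j with ⟨-, h⟩ | ⟨j', hj', h, -⟩
        · rw [h]
          exact hxk.le
        · rw [h]
          exact hl j' hj'
      · rw [hbi i hik hil]
        rcases hb j with ⟨-, h⟩ | ⟨j', -, h, -⟩
        · rw [h]
          exact (hxi i hik hil).le
        · rw [h]
          exact ha.min i j'
  · intro i j hij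
    rcases hb i with ⟨hi, h⟩ | ⟨i', hi', h, hi⟩ <;> rcases hb j with ⟨hj, h'⟩ | ⟨j', hj', h', hj⟩
    · rw [hi, hj]
    · exact absurd (h.symm.trans (hij.trans h')) (hxa j' hj')
    · exact absurd (h'.symm.trans (hij.symm.trans h)) (hxa i' hi')
    · have : i' = j' := ha.injective (h.symm.trans (hij.trans h'))
      grind
  · intro y
    by_contra! hy
    have hyM : r l y ≤ r l x := by
      refine hmax y ⟨by simpa [hbk] using hy k, fun i hik hil => ?_⟩
      simpa [hbi i hik hil] using hy i
    have := hy l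
    rw [hbl] at this
    omega

end Pivot

section Scarf

variable {ι T : Type*} {r : ι → T ⊕ ι → ℕ}

theorem IsPrimitiveFamily.eq_inl_or_eq_inr [Finite ι] [Nonempty T] {a : ι → T ⊕ ι}
    (hbot : ∀ i t, r i (Sum.inr i) < r i (Sum.inl t))
    (htop : ∀ i j t, j ≠ i → r i (Sum.inl t) < r i (Sum.inr j))
    (ha : IsPrimitiveFamily r a) (i : ι) : (∃ t, a i = Sum.inl t) ∨ a i = Sum.inr i := by
  rcases hi : a i with t | j
  · exact Or.inl ⟨t, rfl⟩
  · right
    by_contra hij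
    have hij : j ≠ i := fun h => hij (by rw [h])
    have hslack : ∀ k, ∃ l, a k = Sum.inr l := by
      intro k
      rcases hk : a k with t | l
      · have := ha.min i k
        rw [hi, hk] at this
        exact absurd (htop i j t hij) (not_lt.2 this)
      · exact ⟨l, rfl⟩
    choose s hs using hslack
    have hsinj : Function.Injective s := fun x y hxy => ha.injective (by rw [hs, hs, hxy])
    have hssurj := Finite.surjective_of_injective hsinj
    obtain ⟨t⟩ := ‹Nonempty T›
    obtain ⟨k, hk⟩ := ha.dominates (Sum.inl t)
    obtain ⟨l, hl⟩ := hssurj k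
    have h1 := ha.min k l
    rw [hs l, hl] at h1
    have := hbot k t
    omega

theorem exists_colorful_primitiveFamily [Finite ι] [Nonempty ι] [Finite T] [Nonempty T]
    (hr : ∀ i, Function.Injective (r i))
    (hbot : ∀ i t, r i (Sum.inr i) < r i (Sum.inl t))
    (htop : ∀ i j t, j ≠ i → r i (Sum.inl t) < r i (Sum.inr j)) (c : T → ι) :
    ∃ a, IsPrimitiveFamily r a ∧ Function.Surjective (Sum.elim c id ∘ a) := by
  classical
  by_contra! hno
  have := Fintype.ofFinite ι
  have := Fintype.ofFinite T
  obtain ⟨i₀⟩ := ‹Nonempty ι›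
  set col : T ⊕ ι → ι := Sum.elim c id with hcol
  let S : Finset ((ι → T ⊕ ι) × ι) := Finset.univ.filter fun p =>
    IsPrimitiveFamily r p.1 ∧ Function.Injective (Function.update (col ∘ p.1) p.2 i₀)
  have hS : ∀ a k, (a, k) ∈ S ↔ IsPrimitiveFamily r a ∧
      Function.Injective (Function.update (col ∘ a) k i₀) := fun a k => by simp [S]
  have hne : ∀ a k, (a, k) ∈ S → col (a k) ≠ i₀ := by
    intro a k h hc
    rw [hS] at h
    refine hno a h.1 (Finite.surjective_of_injective ?_)
    rw [← Function.update_eq_self k (col ∘ a)]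
    simpa [hc] using h.2
  have heven : Even S.card := by
    refine even_card_of_existsUnique_symm S
      (fun p q => p.1 = q.1 ∧ p.2 ≠ q.2 ∧ col (p.1 p.2) = col (p.1 q.2)) (by simp) ?_ ?_
    · rintro ⟨a, k⟩ - ⟨b, l⟩ - ⟨h1, h2, h3⟩
      dsimp only at *
      subst h1
      exact ⟨rfl, h2.symm, h3.symm⟩
    · rintro ⟨a, k⟩ hak
      have hn := hne a k hak
      obtain ⟨ha, hinj⟩ := (hS a k).1 hak
      obtain ⟨l, hl⟩ := Finite.surjective_of_injective hinj (col (a k))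
      have hlk : l ≠ k := by
        rintro rfl
        exact hn (by simpa using hl.symm)
      have hl' : col (a l) = col (a k) := by simpa [hlk] using hl
      refine ⟨(a, l), ⟨(hS a l).2 ⟨ha, ?_⟩, rfl, hlk.symm, hl'.symm⟩, ?_⟩
      · have : Function.update (col ∘ a) l i₀ =
            Function.update (col ∘ a) k i₀ ∘ Equiv.swap k l := by
          funext i
          by_cases hil : i = l
          · simp [hil]
          · by_cases hik : i = k
            · simp [hik, hlk, hlk.symm, hl']
            · simp [hil, hik, Equiv.swap_apply_of_ne_of_ne]
        rw [this]
        exact hinj.comp (Equiv.injective _)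
      · rintro ⟨b, l'⟩ ⟨-, h1, h2, h3⟩
        dsimp only at *
        subst h1
        have : l' = l := hinj (by simp [hlk, h2.symm, hl', h3.symm])
        rw [this]
  obtain ⟨t₀, -, ht₀⟩ := Finset.exists_max_image (Finset.univ : Finset T)
    (fun t => r i₀ (Sum.inl t)) Finset.univ_nonempty
  let a₀ : ι → T ⊕ ι := Function.update Sum.inr i₀ (Sum.inl t₀)
  have ha₀i : ∀ i, i ≠ i₀ → a₀ i = Sum.inr i := fun i hi => by simp [a₀, hi]
  have ha₀0 : a₀ i₀ = Sum.inl t₀ := by simp [a₀]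
  have hupd : Function.update (col ∘ a₀) i₀ i₀ = id := by
    funext i
    by_cases hi : i = i₀
    · simp [hi]
    · simp [hi, ha₀i, hcol]
  have ha₀ : IsPrimitiveFamily r a₀ := by
    refine ⟨fun i j => ?_, fun i j hij => ?_, fun y => ?_⟩
    · by_cases hij : i = j
      · rw [hij]
      · by_cases hi : i = i₀
        · have hj : j ≠ i₀ := fun h => hij (hi.trans h.symm)
          rw [ha₀i j hj, hi, ha₀0]
          exact (htop _ _ _ hj).le
        · rw [ha₀i i hi]
          by_cases hj : j = i₀
          · rw [hj, ha₀0]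
            exact (hbot _ _).le
          · rw [ha₀i j hj]
            exact ((hbot i t₀).trans (htop i j t₀ (Ne.symm hij))).le
    · by_cases hi : i = i₀ <;> by_cases hj : j = i₀
      · rw [hi, hj]
      · simp [hi, ha₀0, ha₀i j hj] at hij
      · simp [hj, ha₀0, ha₀i i hi] at hij
      · simpa [ha₀i i hi, ha₀i j hj] using hij
    · rcases y with t | j
      · exact ⟨i₀, by simpa [ha₀0] using ht₀ t⟩
      · refine ⟨j, ?_⟩
        by_cases hj : j = i₀
        · rw [hj, ha₀0]
          exact (hbot _ _).le
        · rw [ha₀i j hj]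
  have hmem : (a₀, i₀) ∈ S := (hS _ _).2 ⟨ha₀, by rw [hupd]; exact Function.injective_id⟩
  have hexc : ∀ a k, (a, k) ∈ S → (∀ i, i ≠ k → a i = Sum.inr i) → (a, k) = (a₀, i₀) := by
    intro a k hak hs
    obtain ⟨ha, hinj⟩ := (hS a k).1 hak
    have hk : k = i₀ := by
      by_contra hk
      refine hk (hinj ?_)
      have := hs i₀ (Ne.symm hk)
      simp [Ne.symm hk, this, hcol]
    subst hk
    have h0 : a k = Sum.inl t₀ := by
      rcases ha.eq_inl_or_eq_inr hbot htop k with ⟨t, ht⟩ | h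
      · obtain ⟨i, hi⟩ := ha.dominates (Sum.inl t₀)
        by_cases hik : i = k
        · subst hik
          rw [ht] at hi ⊢
          exact hr i (le_antisymm (ht₀ t (Finset.mem_univ _)) hi)
        · rw [hs i hik] at hi
          exact absurd (hbot i t₀) (not_lt.2 hi)
      · exact absurd (by rw [h]; simp [hcol]) (hne a k hak)
    have : a = a₀ := by
      funext i
      by_cases hi : i = k
      · rw [hi, h0, ha₀0]
      · rw [hs i hi, ha₀i i hi]
    rw [this]
  have hpivot_mem : ∀ {a k b l}, (a, k) ∈ S → IsPrimitiveFamily r b → IsPivot a k b l →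
      (b, l) ∈ S := by
    intro a k b l hak hb h
    refine (hS b l).2 ⟨hb, ?_⟩
    have : Function.update (col ∘ b) l i₀ =
        Function.update (col ∘ a) k i₀ ∘ Equiv.swap k l := by
      funext i
      by_cases hil : i = l
      · simp [hil]
      · by_cases hik : i = k
        · subst hik
          simp [h.1, h.1.symm, h.2.1]
        · simp [hil, hik, Equiv.swap_apply_of_ne_of_ne, h.2.2 i hik hil]
    rw [this]
    exact ((hS a k).1 hak).2.comp (Equiv.injective _)
  have hodd : Even (S.erase (a₀, i₀)).card := by
    refine even_card_of_existsUnique_symm _ (fun p q => IsPivot p.1 p.2 q.1 q.2)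
      (fun x _ h => h.1 rfl) (fun x _ y _ h => h.symm) ?_
    rintro ⟨a, k⟩ hak
    obtain ⟨hak0, hak⟩ := Finset.mem_erase.1 hak
    obtain ⟨ha, hinj⟩ := (hS a k).1 hak
    have hslack : ∃ i, i ≠ k ∧ a i ≠ Sum.inr i := by
      by_contra! h
      exact hak0 (hexc a k hak h)
    obtain ⟨i₁, hi₁k, hi₁⟩ := hslack
    obtain ⟨l, hlk, hl⟩ := Finset.exists_min_image (Finset.univ.filter fun i => i ≠ k)
      (fun i => r k (a i)) ⟨i₁, by simpa using hi₁k⟩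
    have hlk : l ≠ k := by simpa using hlk
    have hl : ∀ i, i ≠ k → r k (a l) ≤ r k (a i) := fun i hi => hl i (by simpa using hi)
    have hpar := ha.eq_inl_or_eq_inr hbot htop
    have hal : ∃ t, a l = Sum.inl t := by
      refine (hpar l).resolve_right fun h => ?_
      obtain ⟨t, ht⟩ := (hpar i₁).resolve_right hi₁
      have := hl i₁ hi₁k
      rw [h, ht] at this
      exact absurd (htop k l t hlk) (not_lt.2 this)
    obtain ⟨b, hb, hpiv⟩ := ha.exists_pivot hlk.symm hl ⟨Sum.inr l, by
      obtain ⟨t, ht⟩ := hal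
      rw [ht]
      exact htop k l t hlk, by
      intro i hik hil
      rcases hpar i with ⟨t, ht⟩ | h
      · rw [ht]
        exact htop i l t (Ne.symm hil)
      · rw [h]
        exact (hbot i t₀).trans (htop i l t₀ (Ne.symm hil))⟩
    refine ⟨(b, l), ⟨Finset.mem_erase.2 ⟨?_, hpivot_mem hak hb hpiv⟩, hpiv⟩, ?_⟩
    · intro h
      obtain ⟨t, ht⟩ := hal
      have hb0 : b = a₀ := congrArg Prod.fst h
      have hl0 : l = i₀ := congrArg Prod.snd h
      have := hpiv.2.1
      rw [hb0, ha₀i k (hl0 ▸ hlk.symm), ht] at this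
      exact Sum.inr_ne_inl this
    · rintro ⟨b', l'⟩ ⟨hb', hpiv'⟩
      have hb' := ((hS _ _).1 (Finset.mem_erase.1 hb').2).1
      obtain ⟨h1, h2⟩ := IsPivot.unique hr ha hb hb' hpiv hpiv'
      rw [h1, h2]
  have := Finset.card_erase_add_one hmem
  rw [← this, Nat.even_add_one] at heven
  exact heven hodd

end Scarf

section Brouwer

variable {ι : Type*} [Fintype ι]

/-- Every colouring of the lattice points of the simplex `∑ i, x i = N` has a point `m` near which
each colour `i` with `m i ≠ 0` occurs. -/
theorem exists_almost_colorful_point [Nonempty ι] (N : ℕ) (c : (ι → ℕ) → ι) :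
    ∃ m : ι → ℕ, ∑ i, m i ≤ N ∧ N < ∑ i, (m i + 1) ∧
      ∀ i, m i = 0 ∨ ∃ t : ι → ℕ, ∑ j, t j = N ∧ c t = i ∧
        ∀ j, m j ≤ t j ∧ t j ≤ m j + Fintype.card ι := by
  classical
  let T := {x : ι → ℕ // ∑ i, x i = N}
  have hle : ∀ (x : T) i, x.1 i ≤ N := fun x i =>
    (Finset.single_le_sum (fun _ _ => Nat.zero_le _) (Finset.mem_univ i)).trans x.2.le
  have : Finite T := by
    refine Finite.of_injective (β := ι → Fin (N + 1))
      (fun x i => ⟨x.1 i, Nat.lt_succ_of_le (hle x i)⟩) fun x y h => Subtype.ext (funext fun i => ?_)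
    simpa using congrFun h i
  have : Fintype T := Fintype.ofFinite T
  have : Nonempty T := ⟨⟨Pi.single (Classical.arbitrary ι) N, by simp⟩⟩
  obtain ⟨K, ⟨e⟩⟩ : ∃ K, Nonempty (T ≃ Fin K) := ⟨_, ⟨Fintype.equivFin T⟩⟩
  let e' := Fintype.equivFin ι
  let r : ι → T ⊕ ι → ℕ := fun i => Sum.elim (fun x => 1 + (x.1 i * K + e x))
    (fun j => if j = i then 0 else 1 + (N * K + K) + e' j)
  have hlt : ∀ i (x : T), r i (Sum.inl x) < 1 + (N * K + K) := by
    intro i x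
    have h1 := Nat.mul_le_mul_right K (hle x i)
    have h2 := (e x).2
    simp only [r, Sum.elim_inl]
    omega
  have hbot : ∀ i t, r i (Sum.inr i) < r i (Sum.inl t) := fun i t => by simp [r]
  have htop : ∀ i j t, j ≠ i → r i (Sum.inl t) < r i (Sum.inr j) := by
    intro i j t hij
    have := hlt i t
    have : r i (Sum.inr j) = 1 + (N * K + K) + e' j := by simp [r, hij]
    omega
  have hlex : ∀ i (x y : T), r i (Sum.inl x) ≤ r i (Sum.inl y) → x.1 i ≤ y.1 i := by
    intro i x y h
    simp only [r, Sum.elim_inl] at h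
    by_contra! hc
    have h1 := Nat.mul_le_mul_right K (Nat.succ_le_of_lt hc)
    have h2 := (e y).2
    rw [Nat.succ_mul] at h1
    omega
  have hr : ∀ i, Function.Injective (r i) := by
    rintro i (x | j) (y | k) h
    · have hxy := le_antisymm (hlex i x y h.le) (hlex i y x h.ge)
      simp only [r, Sum.elim_inl, hxy] at h
      have : e x = e y := Fin.ext (by omega)
      rw [e.injective this]
    · by_cases hk : k = i
      · subst hk
        exact absurd h (hbot _ _).ne'
      · exact absurd h (htop _ _ _ hk).ne
    · by_cases hj : j = i
      · subst hj
        exact absurd h (hbot _ _).ne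
      · exact absurd h (htop _ _ _ hj).ne'
    · by_cases hj : j = i <;> by_cases hk : k = i
      · rw [hj, hk]
      · simp only [r, Sum.elim_inr, hj, hk, if_true, if_false] at h
        omega
      · simp only [r, Sum.elim_inr, hj, hk, if_true, if_false] at h
        omega
      · simp only [r, Sum.elim_inr, hj, hk, if_false] at h
        have : e' j = e' k := Fin.ext (by omega)
        rw [e'.injective this]
  obtain ⟨a, ha, hsurj⟩ := exists_colorful_primitiveFamily hr hbot htop (fun x : T => c x.1)
  have hpar := ha.eq_inl_or_eq_inr hbot htop
  let m : ι → ℕ := fun i => Sum.elim (fun x : T => x.1 i) (fun _ => 0) (a i)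
  have hm : ∀ i j (x : T), a j = Sum.inl x → m i ≤ x.1 i := by
    intro i j x hx
    rcases hpar i with ⟨t, ht⟩ | h
    · have := ha.min i j
      rw [ht, hx] at this
      simpa [m, ht] using hlex i _ _ this
    · simp [m, h]
  have hsum : N < ∑ i, (m i + 1) := by
    by_contra! hc
    obtain ⟨y, hym⟩ : ∃ y : T, ∀ i, m i + 1 ≤ y.1 i := by
      refine ⟨⟨fun i => m i + 1 +
        (Pi.single (Classical.arbitrary ι) (N - ∑ i, (m i + 1)) : ι → ℕ) i, ?_⟩,
        fun i => Nat.le_add_right _ _⟩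
      rw [Finset.sum_add_distrib, Finset.sum_pi_single']
      simp only [Finset.mem_univ, if_true]
      omega
    obtain ⟨i, hi⟩ := ha.dominates (Sum.inl y)
    rcases hpar i with ⟨t, ht⟩ | h
    · rw [ht] at hi
      have h1 := hlex i _ _ hi
      have h2 := hym i
      simp only [m, ht, Sum.elim_inl] at h2
      omega
    · rw [h] at hi
      exact absurd (hbot i y) (not_lt.2 hi)
  obtain ⟨j₀, t₀, hj₀⟩ : ∃ j t, a j = Sum.inl t := by
    by_contra! h
    obtain ⟨t⟩ := ‹Nonempty T›
    obtain ⟨i, hi⟩ := ha.dominates (Sum.inl t)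
    rw [(hpar i).resolve_left fun ⟨t, ht⟩ => h i t ht] at hi
    exact absurd (hbot i t) (not_lt.2 hi)
  refine ⟨m, (Finset.sum_le_sum fun i _ => hm i j₀ t₀ hj₀).trans t₀.2.le, hsum, fun i => ?_⟩
  rcases hpar i with ⟨t, ht⟩ | h
  · obtain ⟨j, hj⟩ := hsurj i
    rcases hpar j with ⟨x, hx⟩ | hjs
    swap
    · rw [Function.comp_apply, hjs] at hj
      have hj : j = i := hj
      rw [hj, ht] at hjs
      exact absurd hjs Sum.inl_ne_inr
    refine Or.inr ⟨x.1, x.2, by simpa [hx] using hj, fun l => ⟨hm l j x hx, ?_⟩⟩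
    have h1 : ∑ k ∈ Finset.univ.erase l, m k ≤ ∑ k ∈ Finset.univ.erase l, x.1 k :=
      Finset.sum_le_sum fun k _ => hm k j x hx
    have h2 := Finset.add_sum_erase Finset.univ m (Finset.mem_univ l)
    have h3 := Finset.add_sum_erase Finset.univ x.1 (Finset.mem_univ l)
    rw [Finset.sum_add_distrib] at hsum
    simp only [Finset.sum_const, Finset.card_univ, smul_eq_mul, mul_one] at hsum
    have := x.2
    omega
  · exact Or.inl (by simp [m, h])

/-- **Brouwer's fixed point theorem** for the standard simplex. -/
theorem exists_fixedPoint_stdSimplex [Nonempty ι] (p : (ι → ℝ) → (ι → ℝ))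
    (hp : ContinuousOn p (stdSimplex ℝ ι)) (hmaps : Set.MapsTo p (stdSimplex ℝ ι) (stdSimplex ℝ ι)) :
    ∃ x ∈ stdSimplex ℝ ι, p x = x := by
  classical
  let sc : ℕ → (ι → ℕ) → (ι → ℝ) := fun N t i => (t i : ℝ) / (N + 1 : ℕ)
  have hsc : ∀ N t, ∑ i, t i = N + 1 → sc N t ∈ stdSimplex ℝ ι := by
    intro N t ht
    refine ⟨fun i => by positivity, ?_⟩
    simp only [sc]
    rw [← Finset.sum_div, ← Nat.cast_sum, ht]
    exact div_self (by positivity)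
  have hcol : ∀ N t, ∃ i, ∑ i, t i = N + 1 → sc N t i ≤ p (sc N t) i := by
    intro N t
    by_cases ht : ∑ i, t i = N + 1
    · have h := hsc N t ht
      obtain ⟨i, -, hi⟩ := Finset.exists_le_of_sum_le Finset.univ_nonempty
        (h.2.trans (hmaps h).2.symm).le
      exact ⟨i, fun _ => hi⟩
    · exact ⟨Classical.arbitrary ι, fun h => absurd h ht⟩
  choose c hc using hcol
  choose m hm1 hm2 hm3 using fun N => exists_almost_colorful_point (N + 1) (c N)
  set n := Fintype.card ι
  have hpos : ∀ N : ℕ, (0 : ℝ) < (N + 1 : ℕ) := fun N => by positivity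
  have hbox : ∀ N, sc N (m N) ∈ Set.Icc (0 : ι → ℝ) 1 := by
    refine fun N => ⟨fun i => div_nonneg (by positivity) (hpos N).le, fun i => ?_⟩
    refine (div_le_one (hpos N)).2 (Nat.cast_le.2 ?_)
    exact (Finset.single_le_sum (fun _ _ => Nat.zero_le _) (Finset.mem_univ i)).trans (hm1 N)
  obtain ⟨x, hx, φ, hφ, hlim⟩ := isCompact_Icc.tendsto_subseq hbox
  have hlim_i : ∀ i, Filter.Tendsto (fun N => sc (φ N) (m (φ N)) i) Filter.atTop (nhds (x i)) :=
    fun i => (tendsto_pi_nhds.1 hlim) i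
  have hsmall : Filter.Tendsto (fun N => (n : ℝ) / (φ N + 1 : ℕ)) Filter.atTop (nhds 0) := by
    have := (tendsto_const_div_atTop_nhds_zero_nat (n : ℝ)).comp
      ((Filter.tendsto_add_atTop_nat 1).comp hφ.tendsto_atTop)
    exact this
  have hsumlim : Filter.Tendsto (fun N => ∑ i, sc (φ N) (m (φ N)) i) Filter.atTop
      (nhds (∑ i, x i)) := tendsto_finsetSum _ fun i _ => hlim_i i
  have hxs : x ∈ stdSimplex ℝ ι := by
    refine ⟨fun i => hx.1 i, le_antisymm ?_ ?_⟩
    · refine le_of_tendsto' hsumlim fun N => ?_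
      simp only [sc]
      rw [← Finset.sum_div, div_le_one (hpos _), ← Nat.cast_sum]
      exact Nat.cast_le.2 (hm1 _)
    · have := hsumlim.add hsmall
      rw [add_zero] at this
      refine ge_of_tendsto' this fun N => ?_
      simp only [sc]
      rw [← Finset.sum_div, ← add_div, le_div_iff₀ (hpos _), one_mul, ← Nat.cast_sum,
        ← Nat.cast_add]
      refine Nat.cast_le.2 ?_
      have := hm2 (φ N)
      rw [Finset.sum_add_distrib] at this
      simp only [Finset.sum_const, Finset.card_univ, smul_eq_mul, mul_one] at this
      exact this.le
  have hle : ∀ i, x i ≤ p x i := by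
    intro i
    rcases (hx.1 i).eq_or_lt with h0 | h0
    · rw [← h0]
      exact (hmaps hxs).1 i
    have hev : ∀ᶠ N in Filter.atTop, m (φ N) i ≠ 0 := by
      filter_upwards [(hlim_i i).eventually (lt_mem_nhds h0)] with N hN h
      simp [sc, h] at hN
    have hw : ∀ N, ∃ t : ι → ℕ, m (φ N) i ≠ 0 → ∑ j, t j = φ N + 1 ∧ c (φ N) t = i ∧
        ∀ j, m (φ N) j ≤ t j ∧ t j ≤ m (φ N) j + n := by
      intro N
      rcases hm3 (φ N) i with h | ⟨t, ht⟩
      · exact ⟨0, fun h' => absurd h h'⟩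
      · exact ⟨t, fun _ => ht⟩
    choose t ht using hw
    have htlim : Filter.Tendsto (fun N => sc (φ N) (t N)) Filter.atTop (nhds x) := by
      refine tendsto_pi_nhds.2 fun j => ?_
      have hup := (hlim_i j).add hsmall
      rw [add_zero] at hup
      refine tendsto_of_tendsto_of_tendsto_of_le_of_le' (hlim_i j) hup ?_ ?_
      · filter_upwards [hev] with N hN
        exact div_le_div_of_nonneg_right (Nat.cast_le.2 ((ht N hN).2.2 j).1) (hpos _).le
      · filter_upwards [hev] with N hN
        simp only [sc]
        rw [← add_div]
        refine div_le_div_of_nonneg_right ?_ (hpos _).le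
        exact_mod_cast ((ht N hN).2.2 j).2
    have hmem : ∀ᶠ N in Filter.atTop, sc (φ N) (t N) ∈ stdSimplex ℝ ι := by
      filter_upwards [hev] with N hN
      exact hsc _ _ (ht N hN).1
    have hplim := (hp x hxs).tendsto.comp (tendsto_nhdsWithin_iff.2 ⟨htlim, hmem⟩)
    refine le_of_tendsto_of_tendsto ((tendsto_pi_nhds.1 htlim) i) ((tendsto_pi_nhds.1 hplim) i) ?_
    filter_upwards [hev] with N hN
    have := hc (φ N) (t N) (ht N hN).1
    rwa [(ht N hN).2.1] at this
  refine ⟨x, hxs, funext fun i => ?_⟩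
  have := (Finset.sum_eq_sum_iff_of_le fun i _ => hle i).1 (hxs.2.trans (hmaps hxs).2.symm)
  exact (this i (Finset.mem_univ i)).symm

end Brouwer

theorem exists_fixedPoint_cube {d : ℕ} (w : (Fin d → ℝ) → (Fin d → ℝ))
    (hw : ContinuousOn w (cube d 1)) (hmaps : Set.MapsTo w (cube d 1) (cube d 1)) :
    ∃ x ∈ cube d 1, w x = x := by
  obtain ⟨M, hM, hdM⟩ : ∃ M : ℝ, 0 < M ∧ (d : ℝ) * 2 ≤ M :=
    ⟨2 * (d + 1), by positivity, by linarith⟩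
  let q : (Option (Fin d) → ℝ) → (Fin d → ℝ) := fun z k => max (-1) (min 1 (M * z (some k) - 1))
  have hq : ∀ z, q z ∈ cube d 1 := fun z k =>
    abs_le.2 ⟨le_max_left _ _, max_le (by norm_num) (min_le_left _ _)⟩
  have hqc : Continuous q := by fun_prop
  let p : (Option (Fin d) → ℝ) → (Option (Fin d) → ℝ) := fun z o =>
    o.elim (1 - ∑ k, (w (q z) k + 1) / M) fun k => (w (q z) k + 1) / M
  have hwq : Continuous fun z => w (q z) := hw.comp_continuous hqc hq
  have hpc : Continuous p := by
    refine continuous_pi fun o => ?_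
    have hk : ∀ k, Continuous fun z => (w (q z) k + 1) / M := fun k =>
      (((continuous_apply k).comp hwq).add continuous_const).div_const M
    rcases o with _ | k
    · exact continuous_const.sub (continuous_finsetSum _ fun k _ => hk k)
    · exact hk k
  have hps : Set.MapsTo p (stdSimplex ℝ _) (stdSimplex ℝ _) := by
    intro z _
    have hb := fun k => abs_le.1 (hmaps (hq z) k)
    refine ⟨fun o => ?_, by simp [p, Fintype.sum_option]⟩
    rcases o with _ | k
    · simp only [p, Option.elim_none, sub_nonneg]
      calc ∑ k, (w (q z) k + 1) / M ≤ ∑ _k : Fin d, 2 / M :=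
            Finset.sum_le_sum fun k _ =>
              div_le_div_of_nonneg_right (by linarith [(hb k).2]) hM.le
        _ ≤ 1 := by
            rw [Finset.sum_const, Finset.card_univ, Fintype.card_fin, nsmul_eq_mul, ← mul_div_assoc,
              div_le_one hM]
            exact hdM
    · exact div_nonneg (by linarith [(hb k).1]) hM.le
  obtain ⟨z, -, hz⟩ := exists_fixedPoint_stdSimplex p hpc.continuousOn hps
  refine ⟨q z, hq z, funext fun k => ?_⟩
  have hk : (w (q z) k + 1) / M = z (some k) := congrFun hz (some k)
  have hk' : M * z (some k) - 1 = w (q z) k := by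
    rw [← hk]
    field_simp
    ring
  have hb := abs_le.1 (hmaps (hq z) k)
  simp only [q] at hb ⊢
  rw [hk', min_eq_right hb.2, max_eq_right hb.1]

/-- The **Poincaré–Miranda theorem** on the cube `[-1, 1]^d`. -/
theorem exists_zero_cube {d : ℕ} (F : (Fin d → ℝ) → (Fin d → ℝ))
    (hF : ContinuousOn F (cube d 1)) (hplus : ∀ k, ∀ x ∈ facePlus d 1 k, 0 < F x k)
    (hminus : ∀ k, ∀ x ∈ faceMinus d 1 k, F x k < 0) : ∃ x ∈ cube d 1, F x = 0 := by
  obtain ⟨x, hx, hfix⟩ := exists_fixedPoint_cube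
    (fun x k => max (-1) (min 1 (x k - F x k))) (by
      refine continuousOn_pi.2 fun k => ?_
      have := (continuousOn_pi.1 hF) k
      fun_prop)
    (fun x _ k => abs_le.2 ⟨le_max_left _ _, max_le (by norm_num) (min_le_left _ _)⟩)
  refine ⟨x, hx, funext fun k => ?_⟩
  have hk : max (-1) (min 1 (x k - F x k)) = x k := congrFun hfix k
  have hb := abs_le.1 (hx k)
  have h1 := hplus k x
  have h2 := hminus k x
  simp only [facePlus, faceMinus, Set.mem_ofPred_eq] at h1 h2
  rw [Pi.zero_apply]
  rcases max_cases (-1) (min 1 (x k - F x k)) with ⟨h, h'⟩ | ⟨h, h'⟩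
  · have := h2 ⟨hx, by linarith⟩
    have := min_le_iff.1 h'
    rcases this with h | h <;> linarith
  · rcases min_cases 1 (x k - F x k) with ⟨g, g'⟩ | ⟨g, g'⟩
    · have := h1 ⟨hx, by linarith⟩
      linarith
    · linarith

theorem isCompact_cube (d : ℕ) (δ : ℝ) : IsCompact (cube d δ) := by
  have : cube d δ = Set.Icc (fun _ => -δ) (fun _ => δ) := by
    ext x
    simp only [cube, Set.mem_ofPred_eq, abs_le, Set.mem_Icc, Pi.le_def]
    exact forall_and
  rw [this]
  exact isCompact_Icc

theorem isCompact_facePlus (d : ℕ) (δ : ℝ) (k : Fin d) : IsCompact (facePlus d δ k) :=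
  (isCompact_cube d δ).inter_right (isClosed_eq (continuous_apply k) continuous_const)

theorem isCompact_faceMinus (d : ℕ) (δ : ℝ) (k : Fin d) : IsCompact (faceMinus d δ k) :=
  (isCompact_cube d δ).inter_right (isClosed_eq (continuous_apply k) continuous_const)

/-- Let `(D, {Dp k, Dm k})` be a Miranda domain with Miranda partition,
`c ∈ ℝ^d`, and `f : D → ℝ^d` continuous with `f^k > c_k` on `Dp k` and `f^k < c_k` on
`Dm k`. Then each margin `η_k` is positive, and every continuous `G : D → ℝ^d` with
`sup_D |G^k - f^k| < η_k` for all `k` hits every target `c'` with `|c'_k - c_k| < η_k`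
for all `k`: there is `θ* ∈ D` with `G(θ*) = c'`. -/
theorem miranda_stability
    (d : ℕ) (D : Set (Fin d → ℝ)) (Dp Dm : Fin d → Set (Fin d → ℝ))
    (hD : IsMirandaPartition d D Dp Dm)
    (c : Fin d → ℝ) (f : (Fin d → ℝ) → (Fin d → ℝ)) (hf : ContinuousOn f D)
    (hplus : ∀ k : Fin d, ∀ θ₁ ∈ Dp k, c k < f θ₁ k)
    (hminus : ∀ k : Fin d, ∀ θ₂ ∈ Dm k, f θ₂ k < c k) :
    (∀ k : Fin d, 0 < mirandaMargin d Dp Dm c f k) ∧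
    ∀ G : (Fin d → ℝ) → (Fin d → ℝ), ContinuousOn G D →
      (∀ k : Fin d, sSup ((fun θ => |G θ k - f θ k|) '' D) < mirandaMargin d Dp Dm c f k) →
      ∀ c' : Fin d → ℝ, (∀ k : Fin d, |c' k - c k| < mirandaMargin d Dp Dm c f k) →
        ∃ θs ∈ D, G θs = c' := by
  obtain ⟨g, ⟨hg, rfl, -⟩, hgk⟩ := hD
  have hsubp : ∀ k, facePlus d 1 k ⊆ cube d 1 := fun k x hx => hx.1
  have hsubm : ∀ k, faceMinus d 1 k ⊆ cube d 1 := fun k x hx => hx.1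
  have hDpc : ∀ k, IsCompact (Dp k) := fun k =>
    (hgk k).1 ▸ (isCompact_facePlus d 1 k).image_of_continuousOn (hg.mono (hsubp k))
  have hDmc : ∀ k, IsCompact (Dm k) := fun k =>
    (hgk k).2 ▸ (isCompact_faceMinus d 1 k).image_of_continuousOn (hg.mono (hsubm k))
  have hDpD : ∀ k, Dp k ⊆ g '' cube d 1 := fun k => (hgk k).1 ▸ Set.image_mono (hsubp k)
  have hDmD : ∀ k, Dm k ⊆ g '' cube d 1 := fun k => (hgk k).2 ▸ Set.image_mono (hsubm k)
  have hDpn : ∀ k, (Dp k).Nonempty := fun k =>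
    (hgk k).1 ▸ Set.Nonempty.image g ⟨fun _ => 1, fun _ => by simp, rfl⟩
  have hDmn : ∀ k, (Dm k).Nonempty := fun k =>
    (hgk k).2 ▸ Set.Nonempty.image g ⟨fun _ => -1, fun _ => by simp, rfl⟩
  have hfk : ∀ k, ContinuousOn (fun θ => f θ k) (g '' cube d 1) := continuousOn_pi.1 hf
  have hIp : ∀ k, IsCompact ((fun θ => f θ k - c k) '' Dp k) := fun k =>
    (hDpc k).image_of_continuousOn (((hfk k).mono (hDpD k)).sub continuousOn_const)
  have hIm : ∀ k, IsCompact ((fun θ => c k - f θ k) '' Dm k) := fun k =>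
    (hDmc k).image_of_continuousOn (continuousOn_const.sub ((hfk k).mono (hDmD k)))
  refine ⟨fun k => ?_, fun G hG hGf c' hc' => ?_⟩
  · obtain ⟨θ₁, h₁, e₁⟩ := (hIp k).sInf_mem ((hDpn k).image _)
    obtain ⟨θ₂, h₂, e₂⟩ := (hIm k).sInf_mem ((hDmn k).image _)
    have := hplus k θ₁ h₁
    have := hminus k θ₂ h₂
    refine mul_pos (by norm_num) (lt_min ?_ ?_)
    · rw [← e₁]
      linarith
    · rw [← e₂]
      linarith
  · have hclose : ∀ k, ∀ θ ∈ g '' cube d 1, |G θ k - f θ k| < mirandaMargin d Dp Dm c f k := by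
      intro k θ hθ
      have hcomp := ((isCompact_cube d 1).image_of_continuousOn hg).image_of_continuousOn
        ((continuousOn_pi.1 hG k).sub (hfk k)).abs
      exact (le_csSup hcomp.bddAbove ⟨θ, hθ, rfl⟩).trans_lt (hGf k)
    have hmp : ∀ k, ∀ θ ∈ Dp k, 2 * mirandaMargin d Dp Dm c f k ≤ f θ k - c k := by
      intro k θ hθ
      have h₁ := csInf_le (hIp k).bddBelow ⟨θ, hθ, rfl⟩
      have h₂ := min_le_left (sInf ((fun θ => f θ k - c k) '' Dp k))
        (sInf ((fun θ => c k - f θ k) '' Dm k))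
      simp only [mirandaMargin] at h₁ ⊢
      linarith
    have hmm : ∀ k, ∀ θ ∈ Dm k, 2 * mirandaMargin d Dp Dm c f k ≤ c k - f θ k := by
      intro k θ hθ
      have h₁ := csInf_le (hIm k).bddBelow ⟨θ, hθ, rfl⟩
      have h₂ := min_le_right (sInf ((fun θ => f θ k - c k) '' Dp k))
        (sInf ((fun θ => c k - f θ k) '' Dm k))
      simp only [mirandaMargin] at h₁ ⊢
      linarith
    obtain ⟨x, hx, hzero⟩ := exists_zero_cube (fun x => G (g x) - c')
      ((hG.comp hg (Set.mapsTo_image g _)).sub continuousOn_const)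
      (fun k x hx => by
        have h₁ := abs_lt.1 (hclose k (g x) ⟨x, hx.1, rfl⟩)
        have h₂ := hmp k (g x) ((hgk k).1 ▸ ⟨x, hx, rfl⟩)
        have h₃ := abs_lt.1 (hc' k)
        simp only [Pi.sub_apply]
        linarith)
      (fun k x hx => by
        have h₁ := abs_lt.1 (hclose k (g x) ⟨x, hx.1, rfl⟩)
        have h₂ := hmm k (g x) ((hgk k).2 ▸ ⟨x, hx, rfl⟩)
        have h₃ := abs_lt.1 (hc' k)
        simp only [Pi.sub_apply]
        linarith)
    exact ⟨g x, ⟨x, hx, rfl⟩, sub_eq_zero.1 hzero⟩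
end
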